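/- Every Abelian group of infinite exponent contains a subgroup isomorphic to one of the following: (1) the integers ℤ; (2) the Prüfer group ℤ(p^∞) for some prime p; (3) a direct sum ⨁_n ℤ(b_n) of cyclic groups with b_1 ≤ b_2 ≤ … and b_n → ∞. -/

import Mathlib

/-- The Prüfer `p`-group `ℤ(p^∞)`: the subgroup of `ℚ/ℤ` consisting of the elements of
`p`-power order. -/
def PruferGroup (p : ℕ) [Fact p.Prime] : AddSubgroup (AddCircle (1 : ℚ)) :=
  AddCommGroup.primaryComponent (AddCircle (1 : ℚ)) p

lemma aux_mem_zmultiples {u v : AddCircle (1 : ℚ)} {N : ℕ} (hN : 0 < N)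
    (hv : addOrderOf v = N) (hu : N • u = 0) : ∃ k : ℤ, k • v = u := by
  obtain ⟨j, -, hj, rfl⟩ := (AddCircle.addOrderOf_eq_pos_iff hN).1 hv
  obtain ⟨i, -, rfl⟩ := (AddCircle.nsmul_eq_zero_iff hN).1 hu
  have hb := Nat.gcd_eq_gcd_ab j N
  rw [hj] at hb
  have hN' : (N : ℚ) ≠ 0 := by positivity
  refine ⟨(i : ℤ) * Nat.gcdA j N, ?_⟩
  rw [← AddCircle.coe_zsmul, ← sub_eq_zero, ← AddCircle.coe_sub, AddCircle.coe_eq_zero_iff]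
  refine ⟨-(i * Nat.gcdB j N), ?_⟩
  have hb' : (1 : ℚ) = j * Nat.gcdA j N + N * Nat.gcdB j N := by exact_mod_cast hb
  simp only [zsmul_eq_mul]
  push_cast
  field_simp
  linear_combination (i : ℚ) * hb'

lemma aux_prufer {G : Type*} [AddCommGroup G] (p : ℕ) [hp : Fact p.Prime] (x : ℕ → G)
    (h0 : x 0 ≠ 0) (h0' : p • x 0 = 0) (hx : ∀ n, p • x (n + 1) = x n) :
    ∃ H : AddSubgroup G, Nonempty (H ≃+ PruferGroup p) := by
  have hpow : ∀ k n, p ^ k • x (n + k) = x n := by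
    intro k
    induction k with
    | zero => simp
    | succ k ih =>
      intro n
      rw [pow_succ, mul_smul, ← add_assoc, hx, ih]
  have htor : ∀ n, p ^ (n + 1) • x n = 0 := by
    intro n
    have := hpow n 0
    rw [zero_add] at this
    rw [pow_succ', mul_smul, this, h0']
  obtain ⟨c, hc⟩ := CharacterModule.exists_character_apply_ne_zero_of_ne_zero h0
  let c' : G →+ AddCircle (1 : ℚ) := c
  have hc : c' (x 0) ≠ 0 := hc
  have hord : ∀ n, addOrderOf (c' (x n)) = p ^ (n + 1) := by
    intro n
    apply addOrderOf_eq_prime_pow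
    · have := hpow n 0
      rw [zero_add] at this
      rw [← map_nsmul, this]
      exact hc
    · rw [← map_nsmul, htor, map_zero]
  let H : AddSubgroup G :=
    { carrier := {y | ∃ (n : ℕ) (k : ℤ), k • x n = y}
      zero_mem' := ⟨0, 0, by simp⟩
      add_mem' := by
        rintro _ _ ⟨n, k, rfl⟩ ⟨m, l, rfl⟩
        refine ⟨n + m, k * p ^ m + l * p ^ n, ?_⟩
        have h1 := hpow m n
        have h2 := hpow n m
        rw [add_comm m n] at h2
        rw [← natCast_zsmul] at h1 h2
        push_cast at h1 h2
        rw [add_smul, mul_smul, mul_smul, h1, h2]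
      neg_mem' := by
        rintro _ ⟨n, k, rfl⟩
        exact ⟨n, -k, by simp⟩ }
  have hmem : ∀ y : H, (c'.comp H.subtype) y ∈ PruferGroup p := by
    rintro ⟨_, n, k, rfl⟩
    refine ⟨n + 1, ?_⟩
    change p ^ (n + 1) • c' (k • x n) = 0
    rw [← map_nsmul, smul_comm, htor, smul_zero, map_zero]
  refine ⟨H, ⟨AddEquiv.ofBijective ((c'.comp H.subtype).codRestrict (PruferGroup p) hmem) ⟨?_, ?_⟩⟩⟩
  · rw [injective_iff_map_eq_zero]
    rintro ⟨_, n, k, rfl⟩ hy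
    have hy : c' (k • x n) = 0 := congrArg Subtype.val hy
    rw [map_zsmul, ← addOrderOf_dvd_iff_zsmul_eq_zero, hord] at hy
    obtain ⟨l, rfl⟩ := hy
    apply Subtype.ext
    change (((p ^ (n + 1) : ℕ) : ℤ) * l) • x n = 0
    rw [mul_comm, mul_smul, natCast_zsmul, htor, smul_zero]
  · rintro ⟨u, m, hu⟩
    have hu : p ^ m • u = 0 := hu
    obtain ⟨k, hk⟩ := aux_mem_zmultiples (pow_pos hp.out.pos (m + 1)) (hord m)
      (u := u) (by rw [pow_succ', mul_smul, hu, smul_zero])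
    refine ⟨⟨k • x m, m, k, rfl⟩, Subtype.ext ?_⟩
    change c' (k • x m) = u
    rw [map_zsmul, hk]

/-- Key divisibility argument. -/
lemma aux_key {G : Type*} [AddCommGroup G] (hexp : AddMonoid.exponent G = 0)
    (ht : ∀ g : G, 0 < addOrderOf g) (F : AddSubgroup G) (hF : (F : Set G).Finite) (N : ℕ)
    (h : ∀ x : G, N < addOrderOf x → ∃ k : ℤ, k • x ≠ 0 ∧ k • x ∈ F) :
    ∃ (p : ℕ) (_ : Fact p.Prime) (H : AddSubgroup G), Nonempty (H ≃+ PruferGroup p) := by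
  classical
  let S : ℕ → Set G := fun M => {y | (∃ q : ℕ, q.Prime ∧ q • y = 0) ∧ y ≠ 0 ∧ ∃ x, M • x = y}
  have hSmono : ∀ M l, S (M * l) ⊆ S M := by
    rintro M l y ⟨h1, h2, x, rfl⟩
    exact ⟨h1, h2, l • x, by rw [mul_smul]⟩
  have hSF : S N.factorial ⊆ F := by
    rintro _ ⟨⟨q, hq, hqy⟩, hy, x, rfl⟩
    obtain ⟨a, m, hm, hn⟩ := Nat.exists_eq_pow_mul_and_not_dvd (ht x).ne' q hq.ne_one
    have hcop : Nat.Coprime q m := (Nat.Prime.coprime_iff_not_dvd hq).2 hm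
    have hm0 : m ≠ 0 := by rintro rfl; simp at hm
    -- the primary part of `x`
    have hordx' : addOrderOf (m • x) = q ^ a := by
      rw [addOrderOf_nsmul' x hm0, hn, Nat.gcd_mul_left_left,
        Nat.mul_div_cancel _ (Nat.pos_of_ne_zero hm0)]
    -- if `m • (N! • x) ∈ F` then `N! • x ∈ F`
    suffices hs : m • (N.factorial • x) ∈ F by
      have hb := Nat.gcd_eq_gcd_ab q m
      rw [hcop] at hb
      have : N.factorial • x = Nat.gcdB q m • (m • (N.factorial • x)) := by
        calc N.factorial • x = (1 : ℤ) • (N.factorial • x) := (one_smul _ _).symm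
          _ = ((q : ℤ) * Nat.gcdA q m + m * Nat.gcdB q m) • (N.factorial • x) := by
              rw [← hb]; simp
          _ = _ := by
              rw [add_smul, mul_comm (q : ℤ), mul_smul, natCast_zsmul, hqy, smul_zero, zero_add,
                mul_comm, mul_smul, natCast_zsmul]
      rw [this]
      exact F.zsmul_mem hs _
    have hne : N.factorial • (m • x) ≠ 0 := by
      intro h0
      rw [smul_comm] at h0
      have d1 := addOrderOf_dvd_iff_nsmul_eq_zero.2 h0
      have d2 := addOrderOf_dvd_iff_nsmul_eq_zero.2 hqy
      have := Nat.dvd_gcd d2 d1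
      rw [hcop] at this
      exact hy (AddMonoid.addOrderOf_eq_one_iff.1 (Nat.dvd_one.1 this))
    have hnd : ¬ q ^ a ∣ N.factorial := by
      rw [← hordx', addOrderOf_dvd_iff_nsmul_eq_zero]; exact hne
    have hlt : N < q ^ a := by
      by_contra hle
      exact hnd (Nat.dvd_factorial (pow_pos hq.pos _) (not_lt.1 hle))
    obtain ⟨k, hk0, hkF⟩ := h (m • x) (by rw [hordx']; exact hlt)
    have hqd : q ^ a ∣ q * N.factorial := by
      rw [← hordx', addOrderOf_dvd_iff_nsmul_eq_zero, mul_smul, smul_comm N.factorial m,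
        smul_comm q m, hqy, smul_zero]
    have hgcd : (Int.gcd k ((q ^ a : ℕ) : ℤ)) ∣ q ^ a := by
      have := Int.gcd_dvd_right k ((q ^ a : ℕ) : ℤ)
      exact_mod_cast this
    obtain ⟨b, hba, hb⟩ := (Nat.dvd_prime_pow hq).1 hgcd
    have hblt : b < a := by
      refine lt_of_le_of_ne hba ?_
      rintro rfl
      apply hk0
      rw [← addOrderOf_dvd_iff_zsmul_eq_zero, hordx', ← hb]
      exact Int.gcd_dvd_left _ _
    have hqb : (q ^ b) • (m • x) ∈ F := by
      have e := Int.gcd_eq_gcd_ab k ((q ^ a : ℕ) : ℤ)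
      rw [hb] at e
      have hz : ((q ^ a : ℕ) : ℤ) • (m • x) = 0 := by
        rw [natCast_zsmul, ← hordx', addOrderOf_nsmul_eq_zero]
      rw [← natCast_zsmul, e, add_smul, mul_comm, mul_smul,
        mul_comm ((q ^ a : ℕ) : ℤ), mul_smul, hz, smul_zero, add_zero]
      exact F.zsmul_mem hkF _
    have hdiv : q ^ b ∣ N.factorial := by
      have : q ^ (b + 1) ∣ q * N.factorial := (pow_dvd_pow q hblt).trans hqd
      rw [pow_succ'] at this
      exact Nat.dvd_of_mul_dvd_mul_left hq.pos this
    obtain ⟨l, hl⟩ := hdiv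
    rw [smul_comm, hl, mul_comm, mul_smul]
    exact F.nsmul_mem hqb _
  have hSfin : ∀ l, (S (N.factorial * l)).Finite := fun l =>
    hF.subset ((hSmono _ l).trans hSF)
  obtain ⟨k, hk, hkmin⟩ : ∃ k, 0 < k ∧ ∀ l, 0 < l →
      (S (N.factorial * k)).ncard ≤ (S (N.factorial * l)).ncard := by
    have hex : ∃ c, ∃ k, 0 < k ∧ (S (N.factorial * k)).ncard = c := ⟨_, 1, one_pos, rfl⟩
    obtain ⟨k, hk, hc⟩ := Nat.find_spec hex
    exact ⟨k, hk, fun l hl => hc ▸ Nat.find_min' hex ⟨l, hl, rfl⟩⟩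
  obtain ⟨M, hM⟩ : ∃ M, M = N.factorial * k := ⟨_, rfl⟩
  have hMpos : 0 < M := hM ▸ Nat.mul_pos N.factorial_pos hk
  have hS : ∀ l, 0 < l → S (M * l) = S M := by
    intro l hl
    refine Set.eq_of_subset_of_ncard_le (hSmono _ _) ?_ ?_
    · rw [hM, mul_assoc]; exact hkmin _ (Nat.mul_pos hk hl)
    · rw [hM]; exact hSfin k
  have hdiv : ∀ q : ℕ, q.Prime → ∀ n, ∀ x : G, q ^ n • (M • x) = 0 →
      ∃ z, q • (M • z) = M • x := by
    intro q hq n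
    induction n with
    | zero =>
      intro x hx
      refine ⟨0, ?_⟩
      simpa using hx.symm
    | succ n ih =>
      intro x hx
      by_cases hy : q ^ n • (M • x) = 0
      · exact ih x hy
      have hyS : q ^ n • (M • x) ∈ S M :=
        ⟨⟨q, hq, by rw [← mul_smul, ← pow_succ', hx]⟩, hy, q ^ n • x, smul_comm _ _ _⟩
      rw [← hS (q ^ (n + 1)) (pow_pos hq.pos _)] at hyS
      obtain ⟨-, -, c, hc⟩ := hyS
      obtain ⟨z, hz⟩ := ih (x - q • c) (by
        rw [smul_sub, smul_sub, ← hc, sub_eq_zero, ← mul_smul, ← mul_smul]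
        congr 1; ring)
      refine ⟨z + c, ?_⟩
      rw [smul_add, smul_add, hz, smul_sub, smul_comm q M c, sub_add_cancel]
  obtain ⟨g, hg⟩ := (AddMonoid.exponent_eq_zero_iff_forall.1 hexp) M hMpos
  have hd1 : addOrderOf (M • g) ≠ 1 := fun e => hg (AddMonoid.addOrderOf_eq_one_iff.1 e)
  obtain ⟨q, hq, hqd⟩ := Nat.exists_prime_and_dvd hd1
  obtain ⟨d, hd⟩ := hqd
  have hs0 : q • (M • (d • g)) = 0 := by
    rw [smul_comm M d, ← mul_smul, ← hd, addOrderOf_nsmul_eq_zero]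
  have hs1 : M • (d • g) ≠ 0 := by
    rw [smul_comm M d, Ne, ← addOrderOf_dvd_iff_nsmul_eq_zero, hd]
    have hdpos : 0 < d := by
      have := ht (M • g)
      rw [hd] at this
      exact Nat.pos_of_mul_pos_left this
    intro hdd
    have := Nat.le_of_dvd hdpos hdd
    nlinarith [hq.two_le]
  let T := {x : G // ∃ n, q ^ n • (M • x) = 0}
  have hnext : ∀ t : T, ∃ t' : T, q • (M • t'.1) = M • t.1 := by
    rintro ⟨x, n, hx⟩
    obtain ⟨z, hz⟩ := hdiv q hq n x hx
    exact ⟨⟨z, n + 1, by rw [pow_succ, mul_smul, hz, hx]⟩, hz⟩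
  choose nx hnx using hnext
  let t : ℕ → T := fun n => Nat.rec ⟨d • g, 1, by simpa using hs0⟩ (fun _ t => nx t) n
  have : Fact q.Prime := ⟨hq⟩
  exact ⟨q, ⟨hq⟩, aux_prufer q (fun n => M • (t n).1) hs1 hs0 (fun n => hnx (t n))⟩

lemma aux_directSum {G : Type*} [AddCommGroup G] (x : ℕ → G) (F : ℕ → AddSubgroup G)
    (hF : ∀ m n, m < n → x m ∈ F n)
    (hd : ∀ n, ∀ k : ℤ, k • x n ∈ F n → k • x n = 0) :
    ∃ H : AddSubgroup G, Nonempty (H ≃+ DirectSum ℕ fun n => ZMod (addOrderOf (x n))) := by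
  classical
  let f : ∀ n, ZMod (addOrderOf (x n)) →+ G := fun n =>
    ZMod.lift _ ⟨zmultiplesHom G (x n), by simp [addOrderOf_nsmul_eq_zero]⟩
  have hf : ∀ n (k : ℤ), f n (k : ZMod _) = k • x n := by
    intro n k
    simp [f]
  let φ : (DirectSum ℕ fun n => ZMod (addOrderOf (x n))) →+ G := DirectSum.toAddMonoid f
  have hφ : Function.Injective φ := by
    rw [injective_iff_map_eq_zero]
    intro a ha
    by_contra hne
    have hsupp : (DFinsupp.support a).Nonempty := by
      rw [Finset.nonempty_iff_ne_empty, Ne, DFinsupp.support_eq_empty]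
      exact hne
    obtain ⟨n, hn, hmax⟩ := (DFinsupp.support a).exists_max_image id hsupp
    have hsum : φ a = ∑ i ∈ DFinsupp.support a, f i (a i) := by
      have := DFinsupp.sumAddHom_apply f a
      exact this
    rw [ha, ← Finset.add_sum_erase _ _ hn] at hsum
    have hrest : ∑ i ∈ (DFinsupp.support a).erase n, f i (a i) ∈ F n := by
      refine AddSubgroup.sum_mem _ fun i hi => ?_
      rw [Finset.mem_erase] at hi
      have hlt : i < n := lt_of_le_of_ne (hmax i hi.2) hi.1
      obtain ⟨k, hk⟩ := ZMod.intCast_surjective (a i)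
      rw [← hk, hf]
      exact AddSubgroup.zsmul_mem _ (hF i n hlt) _
    have hmem : f n (a n) ∈ F n := by
      rw [eq_neg_of_add_eq_zero_left hsum.symm]
      exact neg_mem hrest
    obtain ⟨k, hk⟩ := ZMod.intCast_surjective (a n)
    rw [← hk, hf] at hmem
    have h0 := hd n k hmem
    rw [← addOrderOf_dvd_iff_zsmul_eq_zero, ← ZMod.intCast_zmod_eq_zero_iff_dvd, hk] at h0
    exact (DFinsupp.mem_support_iff.1 hn) h0
  exact ⟨φ.range, ⟨(AddMonoidHom.ofInjective hφ).symm⟩⟩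

/-- Every Abelian group of infinite exponent contains a subgroup isomorphic to `ℤ`, or to a
Prüfer group `ℤ(p^∞)` for some prime `p`, or to a direct sum `⨁ n, ℤ(b n)` of cyclic groups
with `b` nondecreasing and `b n → ∞`. -/
theorem subgroup_trichotomy_of_infinite_exponent
    (G : Type*) [AddCommGroup G] (hexp : AddMonoid.exponent G = 0) :
    (∃ H : AddSubgroup G, Nonempty (H ≃+ ℤ)) ∨
    (∃ (p : ℕ) (_ : Fact p.Prime) (H : AddSubgroup G), Nonempty (H ≃+ PruferGroup p)) ∨
    (∃ b : ℕ → ℕ, Monotone b ∧ (∀ n, 0 < b n) ∧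
      Filter.Tendsto b Filter.atTop Filter.atTop ∧
      ∃ H : AddSubgroup G, Nonempty (H ≃+ DirectSum ℕ fun n => ZMod (b n))) := by
  classical
  by_cases ht : ∀ g : G, 0 < addOrderOf g
  swap
  · left
    push Not at ht
    obtain ⟨g, hg⟩ := ht
    have hinj : Function.Injective (zmultiplesHom G g) := by
      rw [injective_iff_map_eq_zero]
      intro k hk
      have hk : k • g = 0 := by simpa using hk
      rw [← addOrderOf_dvd_iff_zsmul_eq_zero, Nat.le_zero.1 hg] at hk
      simpa using hk
    exact ⟨(zmultiplesHom G g).range, ⟨(AddMonoidHom.ofInjective hinj).symm⟩⟩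
  right
  by_cases hP : ∃ (p : ℕ) (_ : Fact p.Prime) (H : AddSubgroup G), Nonempty (H ≃+ PruferGroup p)
  · exact Or.inl hP
  right
  have key : ∀ (F : AddSubgroup G), (F : Set G).Finite → ∀ N : ℕ,
      ∃ x : G, N < addOrderOf x ∧ ∀ k : ℤ, k • x ∈ F → k • x = 0 := by
    intro F hF N
    by_contra hcon
    push Not at hcon
    refine hP (aux_key hexp ht F hF N fun x hx => ?_)
    obtain ⟨k, h1, h2⟩ := hcon x hx
    exact ⟨k, h2, h1⟩
  have hfin : ∀ s : Finset G, ((AddSubgroup.closure (s : Set G) : AddSubgroup G) : Set G).Finite := by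
    intro s
    induction s using Finset.induction_on with
    | empty => simp
    | insert a s _ ih =>
      have ha : ((AddSubgroup.zmultiples a : AddSubgroup G) : Set G).Finite := by
        have : IsOfFinAddOrder a := addOrderOf_pos_iff.1 (ht a)
        exact finite_zmultiples.2 this
      rw [Finset.coe_insert, Set.insert_eq, AddSubgroup.closure_union,
        ← AddSubgroup.zmultiples_eq_closure, AddSubgroup.normal_add]
      exact ha.add ih
  obtain ⟨f, hf1, hf2⟩ := exists_seq_of_forall_finset_exists
    (fun t : AddSubgroup G × G => ∀ k : ℤ, k • t.2 ∈ t.1 → k • t.2 = 0)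
    (fun t t' => t.2 ∈ t'.1 ∧ addOrderOf t.2 < addOrderOf t'.2) (by
      intro s _
      obtain ⟨x, hx1, hx2⟩ := key _ (hfin (s.image Prod.snd)) (s.sup fun t => addOrderOf t.2)
      refine ⟨(AddSubgroup.closure ((s.image Prod.snd : Finset G) : Set G), x), hx2, ?_⟩
      intro t hts
      refine ⟨AddSubgroup.subset_closure ?_, lt_of_le_of_lt ?_ hx1⟩
      · exact Finset.mem_coe.2 (Finset.mem_image_of_mem _ hts)
      · exact Finset.le_sup (f := fun t : AddSubgroup G × G => addOrderOf t.2) hts)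
  have hmono : StrictMono fun n => addOrderOf (f n).2 := fun m n hmn => (hf2 m n hmn).2
  exact ⟨fun n => addOrderOf (f n).2, hmono.monotone, fun n => ht _, hmono.tendsto_atTop,
    aux_directSum (fun n => (f n).2) (fun n => (f n).1) (fun m n hmn => (hf2 m n hmn).1) hf1⟩
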